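/- Let {X_n, n≥1} be a φ-mixing sequence of random variables with Σ_{n=1}^∞ φ^{1/2}(n) < ∞. Fix p ∈ (0,1) and assume the common marginal distribution function F possesses a positive continuous density f in a neighborhood N_p of ξ_p such that 0 < sup{f(x) : x ∈ N_p} < ∞, and that f′(x) is bounded in some neighborhood of ξ_p. Then with probability 1, ξ_{p,n} = ξ_p − (F_n(ξ_p) − p)/f(ξ_p) + O((log n)^{1/2} / n^{1/2}) as n → ∞. -/

import Mathlib

open MeasureTheory Filter Set

/-- The σ-algebra generated by the random variables `X i` for `i ∈ S`. -/
noncomputable def sigmaGen {Ω : Type*} (X : ℕ → Ω → ℝ) (S : Set ℕ) : MeasurableSpace Ω :=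
  ⨆ i ∈ S, MeasurableSpace.comap (X i) inferInstance

/-- The φ-mixing coefficients of the sequence `X` with respect to the measure `μ`:
`φ(n) = sup_{k ≥ 1} sup { |P(B|A) - P(B)| : A ∈ σ(X_i, 1 ≤ i ≤ k), P(A) > 0,
B ∈ σ(X_i, i ≥ k + n) }`. -/
noncomputable def phiCoef {Ω : Type*} [MeasurableSpace Ω] (X : ℕ → Ω → ℝ)
    (μ : Measure Ω) (n : ℕ) : ℝ :=
  sSup {r : ℝ | ∃ k : ℕ, 1 ≤ k ∧ ∃ A B : Set Ω,
    MeasurableSet[sigmaGen X {i | 1 ≤ i ∧ i ≤ k}] A ∧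
    MeasurableSet[sigmaGen X {i | k + n ≤ i}] B ∧
    0 < μ A ∧
    r = |(μ (A ∩ B)).toReal / (μ A).toReal - (μ B).toReal|}

/-- The empirical distribution function `F_n(x) = n⁻¹ ∑_{i=1}^n I(X_i ≤ x)`. -/
noncomputable def empDF {Ω : Type*} (X : ℕ → Ω → ℝ) (n : ℕ) (ω : Ω) (x : ℝ) : ℝ :=
  (n : ℝ)⁻¹ * ∑ i ∈ Finset.Icc 1 n, (if X i ω ≤ x then (1 : ℝ) else 0)

/-- The `p`-th quantile `F⁻¹(p) = inf {x : F(x) ≥ p}` of a distribution function `F`. -/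
noncomputable def quantile (F : ℝ → ℝ) (p : ℝ) : ℝ :=
  sInf {x : ℝ | p ≤ F x}

/-- The sample `p`-th quantile `ξ_{p,n} = F_n⁻¹(p) = inf {x : F_n(x) ≥ p}`. -/
noncomputable def sampleQuantile {Ω : Type*} (X : ℕ → Ω → ℝ) (n : ℕ) (ω : Ω) (p : ℝ) : ℝ :=
  sInf {x : ℝ | p ≤ empDF X n ω x}

/-- A chord bound for the exponential on `[-c, c]`. -/
theorem exp_mul_le_cosh_add_mul_sinh {c y : ℝ} (hc : 0 < c) (hy : |y| ≤ c) (s : ℝ) :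
    Real.exp (s * y) ≤ Real.cosh (s * c) + y / c * Real.sinh (s * c) := by
  obtain ⟨h1, h2⟩ := abs_le.mp hy
  have hyc1 : -1 ≤ y / c := by rw [le_div_iff₀ hc]; linarith
  have hyc2 : y / c ≤ 1 := by rw [div_le_iff₀ hc]; linarith
  have h := convexOn_exp.2 (mem_univ (s * c)) (mem_univ (-(s * c)))
    (by linarith : 0 ≤ (1 + y / c) / 2) (by linarith : 0 ≤ (1 - y / c) / 2) (by ring)
  have e : (1 + y / c) / 2 * (s * c) + (1 - y / c) / 2 * -(s * c) = s * y := by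
    field_simp; ring
  simp only [smul_eq_mul] at h
  rw [e] at h
  rw [Real.cosh_eq, Real.sinh_eq]
  linarith

section Azuma

variable {Ω : Type*} {m0 : MeasurableSpace Ω} {μ : Measure Ω}

theorem ae_abs_le_nat_mul_of_increments {M : ℕ → Ω → ℝ} {c : NNReal}
    (hM0 : M 0 =ᵐ[μ] 0) (hinc : ∀ i, ∀ᵐ ω ∂μ, |M (i + 1) ω - M i ω| ≤ c) (i : ℕ) :
    ∀ᵐ ω ∂μ, |M i ω| ≤ i * c := by
  induction i with
  | zero => filter_upwards [hM0] with ω h; simp [h]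
  | succ i ih =>
    filter_upwards [ih, hinc i] with ω h1 h2
    have := abs_add_le (M (i + 1) ω - M i ω) (M i ω)
    rw [sub_add_cancel] at this
    push_cast
    linarith

/-- **Azuma's inequality**: a real martingale started at zero whose increments are bounded
by `c` is sub-Gaussian. -/
theorem MeasureTheory.Martingale.hasSubgaussianMGF [IsProbabilityMeasure μ]
    {ℱ : Filtration ℕ m0} {M : ℕ → Ω → ℝ} {c : NNReal}
    (hM : Martingale M ℱ μ) (hc : 0 < c) (hM0 : M 0 =ᵐ[μ] 0)
    (hinc : ∀ i, ∀ᵐ ω ∂μ, |M (i + 1) ω - M i ω| ≤ c) (n : ℕ) :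
    ProbabilityTheory.HasSubgaussianMGF (M n) (n * c ^ 2) μ := by
  have hbdd := ae_abs_le_nat_mul_of_increments hM0 hinc
  have hmeas (i) : AEStronglyMeasurable (M i) μ := (hM.integrable i).aestronglyMeasurable
  have hexpb (s : ℝ) (i : ℕ) : ∀ᵐ ω ∂μ, ‖Real.exp (s * M i ω)‖ ≤ Real.exp (|s| * (i * c)) := by
    filter_upwards [hbdd i] with ω h
    rw [Real.norm_eq_abs, Real.abs_exp]
    apply Real.exp_le_exp.mpr
    calc s * M i ω ≤ |s * M i ω| := le_abs_self _
      _ = |s| * |M i ω| := abs_mul _ _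
      _ ≤ _ := by gcongr
  have hexpm (s : ℝ) (i : ℕ) : AEStronglyMeasurable (fun ω => Real.exp (s * M i ω)) μ :=
    Real.continuous_exp.comp_aestronglyMeasurable ((hmeas i).const_mul s)
  have hexpi (s : ℝ) (i : ℕ) : Integrable (fun ω => Real.exp (s * M i ω)) μ :=
    .of_bound (hexpm s i) _ (hexpb s i)
  refine ⟨fun s => hexpi s n, fun s => ?_⟩
  have horth (i : ℕ) : ∫ ω, Real.exp (s * M i ω) * (M (i + 1) ω - M i ω) ∂μ = 0 := by
    have hD : Integrable (M (i + 1) - M i) μ := (hM.integrable _).sub (hM.integrable _)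
    have hprod : Integrable ((fun ω => Real.exp (s * M i ω)) * (M (i + 1) - M i)) μ :=
      hD.bdd_mul (hexpm s i) (hexpb s i)
    have hsm : StronglyMeasurable[ℱ i] (fun ω => Real.exp (s * M i ω)) :=
      Real.continuous_exp.comp_stronglyMeasurable ((hM.stronglyMeasurable i).const_mul s)
    have h1 := condExp_mul_of_stronglyMeasurable_left hsm hprod hD
    have h2 : μ[M (i + 1) - M i | ℱ i] =ᵐ[μ] 0 := by
      filter_upwards [condExp_sub (hM.integrable (i + 1)) (hM.integrable i) (ℱ i),
        hM.2 i (i + 1) (Nat.le_succ i), hM.2 i i le_rfl] with ω h h' h''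
      rw [h, Pi.sub_apply, h', h'', sub_self, Pi.zero_apply]
    rw [show (∫ ω, Real.exp (s * M i ω) * (M (i + 1) ω - M i ω) ∂μ) =
      ∫ ω, ((fun ω => Real.exp (s * M i ω)) * (M (i + 1) - M i)) ω ∂μ from rfl,
      ← integral_condExp (ℱ.le i), integral_eq_zero_of_ae]
    filter_upwards [h1, h2] with ω h h'
    rw [h, Pi.mul_apply, h', Pi.zero_apply, mul_zero]
  have key : ∫ ω, Real.exp (s * M n ω) ∂μ ≤ Real.cosh (s * c) ^ n := by
    induction n with
    | zero =>
      rw [integral_congr_ae (g := fun _ => (1 : ℝ))]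
      · simp
      · filter_upwards [hM0] with ω h
        simp [h]
    | succ i ih =>
      have hi2 : Integrable (fun ω => Real.exp (s * M i ω) * (M (i + 1) ω - M i ω)) μ :=
        ((hM.integrable (i + 1)).sub (hM.integrable i)).bdd_mul (hexpm s i) (hexpb s i)
      calc ∫ ω, Real.exp (s * M (i + 1) ω) ∂μ
          ≤ ∫ ω, (Real.cosh (s * c) * Real.exp (s * M i ω) + Real.sinh (s * c) / c *
              (Real.exp (s * M i ω) * (M (i + 1) ω - M i ω))) ∂μ := by
            refine integral_mono_ae (hexpi s _)
              (((hexpi s i).const_mul _).add (hi2.const_mul _)) ?_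
            filter_upwards [hinc i] with ω h
            have := exp_mul_le_cosh_add_mul_sinh (NNReal.coe_pos.mpr hc) h s
            calc Real.exp (s * M (i + 1) ω)
                = Real.exp (s * M i ω) * Real.exp (s * (M (i + 1) ω - M i ω)) := by
                  rw [← Real.exp_add]; ring_nf
              _ ≤ _ := mul_le_mul_of_nonneg_left this (Real.exp_pos _).le
              _ = _ := by ring
        _ = Real.cosh (s * c) * ∫ ω, Real.exp (s * M i ω) ∂μ := by
            rw [integral_add ((hexpi s i).const_mul _) (hi2.const_mul _), integral_const_mul,
              integral_const_mul, horth, mul_zero, add_zero]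
        _ ≤ Real.cosh (s * c) * Real.cosh (s * c) ^ i :=
            mul_le_mul_of_nonneg_left ih (Real.cosh_pos _).le
        _ = _ := by ring
  calc ProbabilityTheory.mgf (M n) μ s ≤ Real.cosh (s * c) ^ n := key
    _ ≤ Real.exp ((s * c) ^ 2 / 2) ^ n :=
        pow_le_pow_left₀ (Real.cosh_pos _).le (Real.cosh_le_exp_half_sq _) n
    _ = _ := by
        rw [← Real.exp_nat_mul]
        push_cast
        ring_nf

end Azuma

section Mixing

variable {Ω : Type*} {m0 : MeasurableSpace Ω} {μ : Measure Ω}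

theorem phiCoef_nonneg (X : ℕ → Ω → ℝ) (n : ℕ) : 0 ≤ phiCoef X μ n := by
  refine Real.sSup_nonneg ?_
  rintro r ⟨k, -, A, B, -, -, -, rfl⟩
  exact abs_nonneg _

variable [IsProbabilityMeasure μ]

theorem sum_comp_sub_le_tsum {b : ℕ → NNReal} (hb : Summable b) (s : Finset ℕ) {m : ℕ}
    (hs : ∀ j ∈ s, m ≤ j) : ∑ j ∈ s, (b (j - m) : ℝ) ≤ ∑' k, (b k : ℝ) := by
  rw [← Finset.sum_image (f := fun k => (b k : ℝ)) (g := fun j => j - m)]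
  · exact (NNReal.summable_coe.mpr hb).sum_le_tsum _ fun _ _ => NNReal.coe_nonneg _
  · intro x hx y hy hxy
    have := hs x hx
    have := hs y hy
    simp only at hxy
    omega

/-- The increments of the Doob martingale of a partial sum are bounded when the conditional
expectations of the summands decay at a summable rate in the time gap. -/
theorem ae_abs_condExp_sum_succ_sub_le {ℱ : Filtration ℕ m0}
    {Y : ℕ → Ω → ℝ} {b : ℕ → NNReal} (hb : Summable b)
    (hmeas : ∀ j, 1 ≤ j → StronglyMeasurable[ℱ j] (Y j)) (hint : ∀ j, Integrable (Y j) μ)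
    (hcond : ∀ i j, 1 ≤ j → i ≤ j → ∀ᵐ ω ∂μ, |(μ[Y j | ℱ i]) ω| ≤ b (j - i)) (n i : ℕ) :
    ∀ᵐ ω ∂μ, |(μ[∑ j ∈ Finset.Icc 1 n, Y j | ℱ (i + 1)]) ω -
      (μ[∑ j ∈ Finset.Icc 1 n, Y j | ℱ i]) ω| ≤ 2 * ∑' k, (b k : ℝ) := by
  have h1 : ∀ᵐ ω ∂μ, ∀ j, 1 ≤ j → i + 1 ≤ j → |(μ[Y j | ℱ (i + 1)]) ω| ≤ b (j - (i + 1)) := by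
    simp only [ae_all_iff]
    exact fun j h h' => hcond (i + 1) j h h'
  have h2 : ∀ᵐ ω ∂μ, ∀ j, 1 ≤ j → i ≤ j → |(μ[Y j | ℱ i]) ω| ≤ b (j - i) := by
    simp only [ae_all_iff]
    exact fun j h h' => hcond i j h h'
  filter_upwards [h1, h2, condExp_finsetSum (s := Finset.Icc 1 n) (fun j _ => hint j) (ℱ (i + 1)),
    condExp_finsetSum (s := Finset.Icc 1 n) (fun j _ => hint j) (ℱ i)] with ω h1 h2 e1 e2
  rw [e1, e2, Finset.sum_apply, Finset.sum_apply, ← Finset.sum_sub_distrib]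
  have hle : ∀ j ∈ Finset.Icc 1 n, |(μ[Y j | ℱ (i + 1)]) ω - (μ[Y j | ℱ i]) ω| ≤
      if i + 1 ≤ j then (b (j - (i + 1)) + b (j - i) : ℝ) else 0 := by
    intro j hj
    rw [Finset.mem_Icc] at hj
    split_ifs with hij
    · exact (abs_sub _ _).trans (add_le_add (h1 j hj.1 hij) (h2 j hj.1 (by omega)))
    · rw [condExp_of_stronglyMeasurable (ℱ.le _)
          ((hmeas j hj.1).mono (ℱ.mono (by omega))) (hint j),
        condExp_of_stronglyMeasurable (ℱ.le _)
          ((hmeas j hj.1).mono (ℱ.mono (by omega))) (hint j), sub_self, abs_zero]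
  refine (Finset.abs_sum_le_sum_abs _ _).trans ((Finset.sum_le_sum hle).trans ?_)
  rw [← Finset.sum_filter, Finset.sum_add_distrib]
  have hA := sum_comp_sub_le_tsum hb ((Finset.Icc 1 n).filter (i + 1 ≤ ·)) (m := i + 1)
    fun j hj => (Finset.mem_filter.mp hj).2
  have hB := sum_comp_sub_le_tsum hb ((Finset.Icc 1 n).filter (i + 1 ≤ ·)) (m := i)
    fun j hj => (Nat.le_succ i).trans (Finset.mem_filter.mp hj).2
  linarith

/-- The partial sums of a bounded adapted sequence whose conditional expectations given the past
decay at a summable rate in the time gap are sub-Gaussian. -/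
theorem hasSubgaussianMGF_sum_of_condExp_le {ℱ : Filtration ℕ m0} (hℱ : ℱ 0 = ⊥)
    {Y : ℕ → Ω → ℝ} {b : ℕ → NNReal} (hb : Summable b) (hb0 : 0 < b 0)
    (hmeas : ∀ j, 1 ≤ j → StronglyMeasurable[ℱ j] (Y j)) (hint : ∀ j, Integrable (Y j) μ)
    (hmean : ∀ j, 1 ≤ j → ∫ ω, Y j ω ∂μ = 0)
    (hcond : ∀ i j, 1 ≤ j → i ≤ j → ∀ᵐ ω ∂μ, |(μ[Y j | ℱ i]) ω| ≤ b (j - i)) (n : ℕ) :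
    ProbabilityTheory.HasSubgaussianMGF (∑ j ∈ Finset.Icc 1 n, Y j)
      (n * (2 * ∑' k, b k) ^ 2) μ := by
  have hsumM : StronglyMeasurable[ℱ n] (∑ j ∈ Finset.Icc 1 n, Y j) := by
    refine Finset.stronglyMeasurable_sum _ fun j hj => ?_
    rw [Finset.mem_Icc] at hj
    exact (hmeas j hj.1).mono (ℱ.mono hj.2)
  have hsumI : Integrable (∑ j ∈ Finset.Icc 1 n, Y j) μ := integrable_finsetSum' _ fun j _ => hint j
  have hpos : 0 < 2 * ∑' k, b k := mul_pos two_pos (NNReal.tsum_pos hb 0 hb0)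
  have hMn : μ[∑ j ∈ Finset.Icc 1 n, Y j | ℱ n] = ∑ j ∈ Finset.Icc 1 n, Y j :=
    condExp_of_stronglyMeasurable (ℱ.le n) hsumM hsumI
  refine ((martingale_condExp (∑ j ∈ Finset.Icc 1 n, Y j) ℱ μ).hasSubgaussianMGF
    hpos ?_ ?_ n).congr (.of_eq hMn)
  · rw [hℱ, condExp_bot]
    refine Eventually.of_forall fun ω => ?_
    simp only [Finset.sum_apply, Pi.zero_apply]
    rw [integral_finsetSum _ fun j _ => hint j]
    exact Finset.sum_eq_zero fun j hj => hmean j (Finset.mem_Icc.mp hj).1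
  · intro i
    have h := ae_abs_condExp_sum_succ_sub_le hb hmeas hint hcond n i
    rw [← NNReal.coe_tsum] at h
    exact h

theorem sigmaGen_mono (X : ℕ → Ω → ℝ) : Monotone (sigmaGen X) :=
  fun _ _ h => biSup_mono fun _ hi => h hi

theorem sigmaGen_le {X : ℕ → Ω → ℝ} (hX : ∀ i, Measurable (X i)) (S : Set ℕ) :
    sigmaGen X S ≤ m0 :=
  iSup₂_le fun i _ => (hX i).comap_le

theorem measurable_sigmaGen (X : ℕ → Ω → ℝ) {S : Set ℕ} {i : ℕ} (hi : i ∈ S) :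
    Measurable[sigmaGen X S] (X i) :=
  Measurable.of_comap_le (le_iSup₂_of_le i hi le_rfl)

/-- The filtration whose `k`-th σ-algebra is generated by `X 1, …, X k`. -/
noncomputable def pastFiltration (X : ℕ → Ω → ℝ) (hX : ∀ i, Measurable (X i)) :
    Filtration ℕ m0 where
  seq k := sigmaGen X {i | 1 ≤ i ∧ i ≤ k}
  mono' _ _ h := sigmaGen_mono X fun _ hi => ⟨hi.1, hi.2.trans h⟩
  le' _ := sigmaGen_le hX _

theorem pastFiltration_zero (X : ℕ → Ω → ℝ) (hX : ∀ i, Measurable (X i)) :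
    pastFiltration X hX 0 = ⊥ := by
  refine le_bot_iff.mp (iSup₂_le fun i hi => ?_)
  exact absurd (hi.1.trans hi.2) (by norm_num)

theorem abs_real_inter_div_sub_le_one (A B : Set Ω) :
    |(μ (A ∩ B)).toReal / (μ A).toReal - (μ B).toReal| ≤ 1 := by
  change |μ.real (A ∩ B) / μ.real A - μ.real B| ≤ 1
  have h1 : μ.real (A ∩ B) / μ.real A ≤ 1 :=
    div_le_one_of_le₀ (measureReal_mono inter_subset_left) measureReal_nonneg
  have h2 : 0 ≤ μ.real (A ∩ B) / μ.real A := div_nonneg measureReal_nonneg measureReal_nonneg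
  have h3 : μ.real B ≤ 1 := measureReal_le_one
  have h4 : 0 ≤ μ.real B := measureReal_nonneg
  rw [abs_le]
  constructor <;> linarith

theorem phiCoef_le_one (X : ℕ → Ω → ℝ) (n : ℕ) : phiCoef X μ n ≤ 1 := by
  refine Real.sSup_le ?_ zero_le_one
  rintro r ⟨k, -, A, B, -, -, -, rfl⟩
  exact abs_real_inter_div_sub_le_one A B

theorem abs_real_inter_sub_mul_le_phiCoef {X : ℕ → Ω → ℝ} {k n : ℕ} {A B : Set Ω}
    (hA : MeasurableSet[sigmaGen X {i | 1 ≤ i ∧ i ≤ k}] A)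
    (hB : MeasurableSet[sigmaGen X {i | k + n ≤ i}] B) :
    |μ.real (A ∩ B) - μ.real A * μ.real B| ≤ phiCoef X μ n * μ.real A := by
  rcases Nat.eq_zero_or_pos k with rfl | hk
  · have hbot : sigmaGen X {i | 1 ≤ i ∧ i ≤ 0} = ⊥ := by
      refine le_bot_iff.mp (iSup₂_le fun i hi => ?_)
      exact absurd (hi.1.trans hi.2) (by norm_num)
    rw [hbot, MeasurableSpace.measurableSet_bot_iff] at hA
    rcases hA with rfl | rfl
    · simp
    · simpa using phiCoef_nonneg X n
  · rcases eq_or_ne (μ A) 0 with h0 | h0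
    · have : μ (A ∩ B) = 0 := measure_mono_null inter_subset_left h0
      simp [Measure.real, h0, this]
    · have hpos : 0 < μ.real A := ENNReal.toReal_pos h0 (measure_ne_top _ _)
      have hle : |μ.real (A ∩ B) / μ.real A - μ.real B| ≤ phiCoef X μ n := by
        refine le_csSup ⟨1, ?_⟩ ⟨k, hk, A, B, hA, hB, pos_iff_ne_zero.mpr h0, rfl⟩
        rintro r ⟨k, -, A, B, -, -, -, rfl⟩
        exact abs_real_inter_div_sub_le_one A B
      calc |μ.real (A ∩ B) - μ.real A * μ.real B|
          = |μ.real (A ∩ B) / μ.real A - μ.real B| * μ.real A := by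
            rw [← abs_of_pos hpos, ← abs_mul, abs_of_pos hpos]
            congr 1
            field_simp
        _ ≤ _ := mul_le_mul_of_nonneg_right hle hpos.le

theorem ae_abs_condExp_le_of_forall_setIntegral {m : MeasurableSpace Ω} (hm : m ≤ m0)
    {Y : Ω → ℝ} (hY : Integrable Y μ) {r : ℝ}
    (h : ∀ A, MeasurableSet[m] A → |∫ ω in A, Y ω ∂μ| ≤ r * μ.real A) :
    ∀ᵐ ω ∂μ, |(μ[Y | m]) ω| ≤ r := by
  have hsm : StronglyMeasurable[m] (μ[Y | m]) := stronglyMeasurable_condExp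
  have hi : Integrable (μ[Y | m]) (μ.trim hm) := integrable_condExp.trim hm hsm
  have hset (A : Set Ω) (hA : MeasurableSet[m] A) :
      |∫ ω in A, (μ[Y | m]) ω ∂(μ.trim hm)| ≤ r * (μ.trim hm).real A := by
    rw [← setIntegral_trim hm hsm hA, setIntegral_condExp hm hY hA, measureReal_def,
      trim_measurableSet_eq hm hA]
    exact h A hA
  have hup : μ[Y | m] ≤ᵐ[μ.trim hm] fun _ => r := by
    refine ae_le_of_forall_setIntegral_le hi (integrable_const _) fun A hA _ => ?_
    rw [setIntegral_const, smul_eq_mul, mul_comm]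
    exact (abs_le.mp (hset A hA)).2
  have hlo : (fun _ => -r) ≤ᵐ[μ.trim hm] μ[Y | m] := by
    refine ae_le_of_forall_setIntegral_le (integrable_const _) hi fun A hA _ => ?_
    rw [setIntegral_const, smul_eq_mul, mul_neg, mul_comm]
    exact (abs_le.mp (hset A hA)).1
  filter_upwards [ae_of_ae_trim hm hup, ae_of_ae_trim hm hlo] with ω h1 h2
  exact abs_le.mpr ⟨h2, h1⟩

/-- The gap-dependent bound on conditional expectations of centred indicators: `1` for gap zero
and the φ-mixing coefficient otherwise. -/
noncomputable def mixingRate (X : ℕ → Ω → ℝ) (μ : Measure Ω) (k : ℕ) : NNReal :=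
  if k = 0 then 1 else (phiCoef X μ k).toNNReal

theorem summable_mixingRate {X : ℕ → Ω → ℝ}
    (hsum : Summable fun n : ℕ => Real.sqrt (phiCoef X μ (n + 1))) :
    Summable (mixingRate X μ) := by
  rw [← NNReal.summable_coe, ← summable_nat_add_iff 1]
  refine Summable.of_nonneg_of_le (fun _ => NNReal.coe_nonneg _) (fun n => ?_) hsum
  have h0 := phiCoef_nonneg (μ := μ) X (n + 1)
  simp only [mixingRate, Nat.add_eq_zero_iff, one_ne_zero, and_false, if_false,
    Real.coe_toNNReal _ h0]
  exact Real.le_sqrt_of_sq_le (by nlinarith [phiCoef_le_one (μ := μ) X (n + 1)])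

/-- A Hoeffding-type inequality for the empirical distribution function of a φ-mixing sequence. -/
theorem hasSubgaussianMGF_sum_indicator_sub {X : ℕ → Ω → ℝ} (hX : ∀ i, Measurable (X i))
    (hsum : Summable fun n : ℕ => Real.sqrt (phiCoef X μ (n + 1)))
    {F : ℝ → ℝ} (hF : ∀ i, 1 ≤ i → ∀ x, F x = (μ {ω | X i ω ≤ x}).toReal) (x : ℝ) (n : ℕ) :
    ProbabilityTheory.HasSubgaussianMGF
      (∑ j ∈ Finset.Icc 1 n, fun ω => (if X j ω ≤ x then (1 : ℝ) else 0) - F x)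
      (n * (2 * ∑' k, mixingRate X μ k) ^ 2) μ := by
  have hset (j : ℕ) : MeasurableSet {ω | X j ω ≤ x} := hX j measurableSet_Iic
  have heq (j : ℕ) : (fun ω => if X j ω ≤ x then (1 : ℝ) else 0) =
      {ω | X j ω ≤ x}.indicator 1 := by
    ext ω; simp [indicator_apply]
  have hint1 (j : ℕ) : Integrable (fun ω => if X j ω ≤ x then (1 : ℝ) else 0) μ := by
    rw [heq]; exact (integrable_const 1).indicator (hset j)
  have hint (j : ℕ) : Integrable (fun ω => (if X j ω ≤ x then (1 : ℝ) else 0) - F x) μ :=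
    (hint1 j).sub (integrable_const _)
  have hsetint (j : ℕ) (hj : 1 ≤ j) {A : Set Ω} (hA : MeasurableSet A) :
      ∫ ω in A, ((if X j ω ≤ x then (1 : ℝ) else 0) - F x) ∂μ =
        μ.real (A ∩ {ω | X j ω ≤ x}) - μ.real A * μ.real {ω | X j ω ≤ x} := by
    rw [integral_sub (hint1 j).integrableOn (integrable_const _), heq,
      integral_indicator_one (hset j), setIntegral_const, smul_eq_mul, hF j hj,
      measureReal_restrict_apply (hset j), inter_comm, measureReal_def μ {ω | X j ω ≤ x}]
  refine hasSubgaussianMGF_sum_of_condExp_le (pastFiltration_zero X hX)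
    (summable_mixingRate hsum) (by simp [mixingRate]) (fun j hj => ?_) hint (fun j hj => ?_)
    (fun i j hj hij => ?_) n
  · have hm : Measurable[pastFiltration X hX j] (X j) := measurable_sigmaGen X ⟨hj, le_rfl⟩
    exact ((measurable_const.ite (hm measurableSet_Iic) measurable_const).sub
      measurable_const).stronglyMeasurable
  · have := hsetint j hj MeasurableSet.univ
    simpa using this
  · rcases hij.eq_or_lt with rfl | hlt
    · have hF0 : 0 ≤ F x ∧ F x ≤ 1 := by
        rw [hF i hj]; exact ⟨ENNReal.toReal_nonneg, measureReal_le_one⟩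
      have h1 : (mixingRate X μ (i - i)) = 1 := by simp [mixingRate]
      rw [h1]
      refine ae_bdd_abs_condExp_of_ae_bdd_abs (Eventually.of_forall fun ω => ?_)
      rw [NNReal.coe_one, abs_le]
      split_ifs <;> constructor <;> linarith
    · have hr : (mixingRate X μ (j - i) : ℝ) = phiCoef X μ (j - i) := by
        rw [mixingRate, if_neg (by omega), Real.coe_toNNReal _ (phiCoef_nonneg X _)]
      rw [hr]
      refine ae_abs_condExp_le_of_forall_setIntegral ((pastFiltration X hX).le i) (hint j)
        fun A hA => ?_
      rw [hsetint j hj ((pastFiltration X hX).le i A hA)]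
      refine abs_real_inter_sub_mul_le_phiCoef hA ?_
      exact measurable_sigmaGen X (show j ∈ {l | i + (j - i) ≤ l} by simp; omega)
        measurableSet_Iic

theorem empDF_mono (X : ℕ → Ω → ℝ) (n : ℕ) (ω : Ω) : Monotone (empDF X n ω) := by
  intro x y hxy
  refine mul_le_mul_of_nonneg_left (Finset.sum_le_sum fun i _ => ?_) (by positivity)
  split_ifs with h1 h2
  · exact le_rfl
  · exact absurd (h1.trans hxy) h2
  · exact zero_le_one
  · exact le_rfl

theorem ProbabilityTheory.HasSubgaussianMGF.measureReal_le_abs_le {S : Ω → ℝ} {v : NNReal}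
    (h : ProbabilityTheory.HasSubgaussianMGF S v μ) {ε : ℝ} (hε : 0 ≤ ε) :
    μ.real {ω | ε ≤ |S ω|} ≤ 2 * Real.exp (-ε ^ 2 / (2 * v)) := by
  have hsub : {ω | ε ≤ |S ω|} ⊆ {ω | ε ≤ S ω} ∪ {ω | ε ≤ (-S) ω} := fun ω hω =>
    (le_abs (a := ε) (b := S ω)).mp hω
  refine (measureReal_mono hsub).trans ((measureReal_union_le _ _).trans ?_)
  linarith [h.measure_ge_le hε, h.neg.measure_ge_le hε]

/-- Along any deterministic sequence of points, the empirical distribution function of a φ-mixing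
sequence deviates from `F` by `O((log n / n)^{1/2})` almost surely. -/
theorem exists_ae_eventually_abs_empDF_sub_lt {X : ℕ → Ω → ℝ} (hX : ∀ i, Measurable (X i))
    (hsum : Summable fun n : ℕ => Real.sqrt (phiCoef X μ (n + 1)))
    {F : ℝ → ℝ} (hF : ∀ i, 1 ≤ i → ∀ x, F x = (μ {ω | X i ω ≤ x}).toReal) :
    ∃ C : ℝ, 0 < C ∧ ∀ x : ℕ → ℝ, ∀ᵐ ω ∂μ, ∀ᶠ n : ℕ in atTop,
      |empDF X n ω (x n) - F (x n)| < C * (√(Real.log n) / √n) := by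
  set c : NNReal := 2 * ∑' k, mixingRate X μ k with hc
  have hc0 : 0 < c := mul_pos two_pos
    (NNReal.tsum_pos (summable_mixingRate hsum) 0 (by simp [mixingRate]))
  have hc0' : (0 : ℝ) < c := hc0
  refine ⟨2 * c, by positivity, fun x => ?_⟩
  let s (n : ℕ) : Set Ω :=
    {ω | 1 ≤ n ∧ 2 * c * (√(Real.log n) / √n) ≤ |empDF X n ω (x n) - F (x n)|}
  have hs (n : ℕ) : μ (s n) ≤ ENNReal.ofReal (2 * (1 / (n : ℝ) ^ 2)) := by
    rcases Nat.eq_zero_or_pos n with rfl | hn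
    · simp [s]
    have hn' : (0 : ℝ) < n := Nat.cast_pos.mpr hn
    have hlog : 0 ≤ Real.log n := Real.log_natCast_nonneg n
    have hsub : s n ⊆ {ω | n * (2 * c * (√(Real.log n) / √n)) ≤
        |(∑ j ∈ Finset.Icc 1 n, fun ω => (if X j ω ≤ x n then (1 : ℝ) else 0) - F (x n)) ω|} := by
      rintro ω ⟨-, hω⟩
      have e : (∑ j ∈ Finset.Icc 1 n,
          fun ω => (if X j ω ≤ x n then (1 : ℝ) else 0) - F (x n)) ω =
          n * (empDF X n ω (x n) - F (x n)) := by
        simp only [Finset.sum_apply, Finset.sum_sub_distrib, Finset.sum_const, Nat.card_Icc,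
          add_tsub_cancel_right, nsmul_eq_mul, empDF]
        field_simp
      rw [mem_ofPred_eq, e, abs_mul, abs_of_pos hn']
      exact mul_le_mul_of_nonneg_left hω hn'.le
    refine (measure_mono hsub).trans ?_
    rw [← ofReal_measureReal]
    refine ENNReal.ofReal_le_ofReal
      (((hasSubgaussianMGF_sum_indicator_sub hX hsum hF (x n) n).measureReal_le_abs_le
        (by positivity)).trans_eq ?_)
    congr 1
    have e : -(n * (2 * c * (√(Real.log n) / √n))) ^ 2 / (2 * ((n * c ^ 2 : NNReal) : ℝ)) =
        -(2 * Real.log n) := by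
      push_cast
      rw [mul_pow, mul_pow, mul_pow, div_pow, Real.sq_sqrt hlog, Real.sq_sqrt hn'.le]
      field_simp
    rw [← hc, e, Real.exp_neg, one_div, two_mul, Real.exp_add, Real.exp_log hn', sq]
  have hfin : ∑' n, μ (s n) ≠ ⊤ :=
    ne_top_of_le_ne_top
      ((Real.summable_one_div_nat_pow.mpr one_lt_two).mul_left 2).tsum_ofReal_ne_top
      (ENNReal.tsum_le_tsum hs)
  filter_upwards [ae_eventually_notMem hfin] with ω hω
  filter_upwards [hω, eventually_ge_atTop 1] with n hn hn1
  by_contra! h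
  exact hn ⟨hn1, h⟩

end Mixing

/-- A monotone function that crosses the level `p` and is continuous at its `p`-quantile
attains `p` there. -/
theorem apply_quantile_eq {F : ℝ → ℝ} (hF : Monotone F) {p : ℝ}
    (hbot : ∃ a, F a < p) (htop : ∃ b, p ≤ F b) (hcont : ContinuousAt F (quantile F p)) :
    F (quantile F p) = p := by
  obtain ⟨a, ha⟩ := hbot
  have hbdd : BddBelow {x | p ≤ F x} := ⟨a, fun x hx => by
    by_contra! h
    exact absurd (hx.trans (hF h.le)) (not_le.mpr ha)⟩
  apply le_antisymm
  · refine le_of_tendsto (hcont.tendsto.mono_left (nhdsWithin_le_nhds (s := Iio (quantile F p)))) ?_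
    filter_upwards [self_mem_nhdsWithin] with x hx
    by_contra! h
    exact absurd (csInf_le hbdd h.le) (not_le.mpr hx)
  · refine ge_of_tendsto (hcont.tendsto.mono_left (nhdsWithin_le_nhds (s := Ioi (quantile F p)))) ?_
    filter_upwards [self_mem_nhdsWithin] with x hx
    obtain ⟨y, hy, hyx⟩ := exists_lt_of_csInf_lt htop hx
    exact le_trans hy (hF hyx.le)

theorem tendsto_sqrt_log_div_sqrt :
    Tendsto (fun n : ℕ => √(Real.log n) / √n) atTop (nhds 0) := by
  have h : Tendsto (fun x : ℝ => Real.log x / x) atTop (nhds 0) :=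
    Real.isLittleO_log_id_atTop.tendsto_div_nhds_zero
  have h2 := (Real.continuous_sqrt.tendsto 0).comp (h.comp tendsto_natCast_atTop_atTop)
  rw [Real.sqrt_zero] at h2
  refine h2.congr fun n => ?_
  simp [Real.sqrt_div (Real.log_natCast_nonneg n)]

/-- **Theorem 2.5.** For a φ-mixing sequence with `∑ φ^{1/2}(n) < ∞` and a marginal
distribution function `F` with positive continuous density `f` near `ξ_p` (with
bounded `f'` in some neighborhood of `ξ_p`), with probability 1,
`ξ_{p,n} = ξ_p - (F_n(ξ_p) - p) / f(ξ_p) + O((log n)^{1/2} / n^{1/2})` as `n → ∞`. -/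
theorem bahadur_thm_2_5 {Ω : Type*} [MeasurableSpace Ω] (μ : Measure Ω)
    [IsProbabilityMeasure μ]
    (X : ℕ → Ω → ℝ) (hX : ∀ i, Measurable (X i))
    (hanti : Antitone (phiCoef X μ))
    (hmix : Tendsto (phiCoef X μ) atTop (nhds 0))
    (hsum : Summable fun n : ℕ => Real.sqrt (phiCoef X μ (n + 1)))
    (F : ℝ → ℝ) (hF : ∀ i, 1 ≤ i → ∀ x, F x = (μ {ω | X i ω ≤ x}).toReal)
    (p : ℝ) (hp : 0 < p ∧ p < 1)
    (Np : Set ℝ) (hNp : Np ∈ nhds (quantile F p))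
    (f : ℝ → ℝ) (hfc : ContinuousOn f Np) (hfpos : ∀ x ∈ Np, 0 < f x)
    (hFf : ∀ x ∈ Np, HasDerivAt F (f x) x)
    (d : ℝ) (hd : IsLUB (f '' Np) d) (hd0 : 0 < d)
    (Np' : Set ℝ) (hNp' : Np' ∈ nhds (quantile F p))
    (f' : ℝ → ℝ) (hff' : ∀ x ∈ Np', HasDerivAt f (f' x) x)
    (hf'bdd : ∃ M : ℝ, ∀ x ∈ Np', |f' x| ≤ M) :
    ∀ᵐ ω ∂μ,
      (fun n : ℕ => sampleQuantile X n ω p -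
          (quantile F p - (empDF X n ω (quantile F p) - p) / f (quantile F p)))
        =O[atTop] fun n : ℕ => Real.log n ^ ((1 : ℝ) / 2) / (n : ℝ) ^ ((1 : ℝ) / 2) := by
  set ξ := quantile F p with hξ
  have hFm : F = fun x => (μ.map (X 1)).real (Iic x) := by
    ext x
    rw [map_measureReal_apply (hX 1) measurableSet_Iic, hF 1 le_rfl]
    rfl
  have : IsProbabilityMeasure (μ.map (X 1)) :=
    Measure.isProbabilityMeasure_map (hX 1).aemeasurable
  have hcdf : F = ProbabilityTheory.cdf (μ.map (X 1)) := by
    ext x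
    rw [ProbabilityTheory.cdf_eq_real, hFm]
  have hmono : Monotone F := hcdf ▸ ProbabilityTheory.monotone_cdf _
  have hderiv : HasDerivAt F (f ξ) ξ := hFf ξ (mem_of_mem_nhds hNp)
  have hfξ : 0 < f ξ := hfpos ξ (mem_of_mem_nhds hNp)
  have hFξ : F ξ = p := by
    refine apply_quantile_eq hmono ?_ ?_ hderiv.continuousAt
    · rw [hcdf]
      exact ((ProbabilityTheory.tendsto_cdf_atBot (μ.map (X 1))).eventually_lt_const hp.1).exists
    · rw [hcdf]
      exact ((ProbabilityTheory.tendsto_cdf_atTop (μ.map (X 1))).eventually_const_le hp.2).exists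
  obtain ⟨C, hC, hdev⟩ := exists_ae_eventually_abs_empDF_sub_lt hX hsum hF
  let r : ℕ → ℝ := fun n => √(Real.log n) / √n
  have hr0 (n : ℕ) : 0 ≤ r n := div_nonneg (Real.sqrt_nonneg _) (Real.sqrt_nonneg _)
  let K : ℝ := 2 * C / f ξ
  have hK : 0 < K := by positivity
  have hKr : Tendsto (fun n => K * r n) atTop (nhds 0) := by
    simpa using tendsto_sqrt_log_div_sqrt.const_mul K
  have hlin := hasDerivAt_iff_isLittleO.mp hderiv |>.def (half_pos hfξ)
  have hup : ∀ᶠ n in atTop, p + C * r n ≤ F (ξ + K * r n) := by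
    have ht : Tendsto (fun n => ξ + K * r n) atTop (nhds ξ) := by
      simpa using tendsto_const_nhds.add hKr
    filter_upwards [ht.eventually hlin] with n hn
    have hKrn : 0 ≤ K * r n := mul_nonneg hK.le (hr0 n)
    rw [add_sub_cancel_left, Real.norm_eq_abs, Real.norm_eq_abs, abs_of_nonneg hKrn, hFξ,
      smul_eq_mul] at hn
    have := (abs_le.mp hn).1
    have e : f ξ * (K * r n) = 2 * (C * r n) := by simp only [K]; field_simp
    linarith
  have hdown : ∀ᶠ n in atTop, F (ξ - K * r n) ≤ p - C * r n := by
    have ht : Tendsto (fun n => ξ - K * r n) atTop (nhds ξ) := by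
      simpa using tendsto_const_nhds.sub hKr
    filter_upwards [ht.eventually hlin] with n hn
    have hKrn : 0 ≤ K * r n := mul_nonneg hK.le (hr0 n)
    rw [sub_sub_cancel_left, Real.norm_eq_abs, Real.norm_eq_abs, abs_neg, abs_of_nonneg hKrn, hFξ,
      smul_eq_mul] at hn
    have := (abs_le.mp hn).2
    have e : f ξ * (K * r n) = 2 * (C * r n) := by simp only [K]; field_simp
    linarith
  filter_upwards [hdev fun _ => ξ, hdev fun n => ξ + K * r n, hdev fun n => ξ - K * r n]
    with ω h0 h1 h2
  refine Asymptotics.IsBigO.of_bound (K + C / f ξ) ?_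
  filter_upwards [h0, h1, h2, hup, hdown] with n h0 h1 h2 hup hdown
  have hle : p ≤ empDF X n ω (ξ + K * r n) := by linarith [(abs_lt.mp h1).1]
  have hlt : empDF X n ω (ξ - K * r n) < p := by linarith [(abs_lt.mp h2).2]
  have hlow : ∀ x ∈ {x | p ≤ empDF X n ω x}, ξ - K * r n ≤ x := fun x hx => by
    by_contra! h
    exact absurd (hx.trans (empDF_mono X n ω h.le)) (not_le.mpr hlt)
  have hq1 : sampleQuantile X n ω p ≤ ξ + K * r n := csInf_le ⟨_, hlow⟩ hle
  have hq2 : ξ - K * r n ≤ sampleQuantile X n ω p := le_csInf ⟨_, hle⟩ hlow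
  rw [← Real.sqrt_eq_rpow, ← Real.sqrt_eq_rpow, Real.norm_eq_abs, Real.norm_eq_abs,
    abs_of_nonneg (hr0 n)]
  rw [hFξ] at h0
  calc |sampleQuantile X n ω p - (ξ - (empDF X n ω ξ - p) / f ξ)|
      = |(sampleQuantile X n ω p - ξ) + (empDF X n ω ξ - p) / f ξ| := by ring_nf
    _ ≤ |sampleQuantile X n ω p - ξ| + |(empDF X n ω ξ - p) / f ξ| := abs_add_le _ _
    _ ≤ K * r n + C * r n / f ξ := by
        refine add_le_add (abs_le.mpr ⟨by linarith, by linarith⟩) ?_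
        rw [abs_div, abs_of_pos hfξ]
        exact div_le_div_of_nonneg_right h0.le hfξ.le
    _ = (K + C / f ξ) * (√(Real.log n) / √n) := by simp only [r]; ring
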